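/- For any ε > 0 and R > 0, there exist a compact set K ⊆ X and t_I ≥ 0 such that for every t ≥ t_I at least one of the following holds: (1) the Lebesgue measure of {s ∈ I : g_tφ_{a,b}(s)·x₀ ∈ K} is at least (1−ε)·|I|; (2) there exists w ∈ ℤ³ \ {0} such that sup_{s∈I} ‖g_tφ_{a,b}(s)w‖ < R. -/

import Mathlib

open MeasureTheory Matrix Filter Topology ENNReal

noncomputable section

/-- `G = SL(3,ℝ)`. -/
abbrev G : Type := Matrix.SpecialLinearGroup (Fin 3) ℝ

instance : TopologicalSpace G :=
  TopologicalSpace.induced (fun g : G => (g : Matrix (Fin 3) (Fin 3) ℝ)) inferInstance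

/-- `Γ = SL(3,ℤ)`, viewed as a (discrete) subgroup of `G`. -/
def Gamma : Subgroup G := (Matrix.SpecialLinearGroup.map (n := Fin 3) (Int.castRingHom ℝ)).range

/-- `X = G/Γ` with the quotient topology. -/
abbrev X : Type := G ⧸ Gamma

instance : MeasurableSpace X := borel X

/-- `x₀ = eΓ ∈ X`. -/
def x₀ : X := ↑(1 : G)

/-- `g_t = diag(e^{2t}, e^{-t}, e^{-t})`. -/
def gSL (t : ℝ) : G :=
  ⟨Matrix.diagonal ![Real.exp (2*t), Real.exp (-t), Real.exp (-t)], by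
    rw [Matrix.det_diagonal, Fin.prod_univ_three]
    simp [← Real.exp_add]
    ring_nf⟩

/-- `φ_{a,b}(s)`, the unipotent matrix with first row `(1, s, as+b)`. -/
def phiSL (a b s : ℝ) : G :=
  ⟨!![1, s, a*s+b; 0, 1, 0; 0, 0, 1], by
    simp [Matrix.det_fin_three, Matrix.vecHead, Matrix.vecTail]⟩

/-- `λ_{a,b}` : the push-forward of the normalized Lebesgue measure on `I = [s₁,s₂]`
under `s ↦ φ_{a,b}(s)·x₀`. -/
def lambdaAB (a b s₁ s₂ : ℝ) : Measure X :=
  Measure.map (fun s => phiSL a b s • x₀)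
    ((volume (Set.Icc s₁ s₂))⁻¹ • volume.restrict (Set.Icc s₁ s₂))

/-- `g_t λ_{a,b}` : the translate of `λ_{a,b}` by `g_t`. -/
def gtLambda (a b s₁ s₂ t : ℝ) : Measure X :=
  Measure.map (fun x => gSL t • x) (lambdaAB a b s₁ s₂)

/-- `sup_{s ∈ [s₁,s₂]} ‖g_t φ_{a,b}(s) v‖` for an integer vector `v`, where `ℝ³`
carries the supremum norm and matrices act by matrix–vector multiplication. -/
def supNormOrbit (a b s₁ s₂ t : ℝ) (v : Fin 3 → ℤ) : ℝ :=
  ⨆ s : Set.Icc s₁ s₂,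
    ‖((gSL t * phiSL a b (s : ℝ) : G) : Matrix (Fin 3) (Fin 3) ℝ).mulVec
        (fun i => (v i : ℝ))‖


lemma reduce_aux (d1 d2 d3 X Y Z : ℝ) (h1 : 0 < d1) (h12 : d1 ≤ d2) (h23 : d2 ≤ d3)
    (hX : 0 ≤ X) (hY : 0 ≤ Y) (hZ : 0 ≤ Z) (al be ga c : ℝ) (hXd : X ≤ al * d1) (hYd : Y ≤ be * d1)
    (hZd : Z ≤ ga * d2) (ha : 0 ≤ al) (hb : 0 ≤ be) (hg : 0 ≤ ga)
    (hc : c + 2 * (al * be * ga) + al^2 + be^2 + ga^2 ≤ 1) :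
    c * (d1 * d2 * d3) ≤ d1 * d2 * d3 - 2 * X * Y * Z - d1 * Z^2 - d2 * Y^2 - d3 * X^2 := by
  have h2 : 0 < d2 := by linarith
  have h3 : 0 < d3 := by linarith
  have e1 : X * Y * Z ≤ (al * d1) * (be * d1) * (ga * d2) := by gcongr
  have e2 : X ^ 2 ≤ (al * d1) ^ 2 := by gcongr
  have e3 : Y ^ 2 ≤ (be * d1) ^ 2 := by gcongr
  have e4 : Z ^ 2 ≤ (ga * d2) ^ 2 := by gcongr
  have f1 : (al * d1) * (be * d1) * (ga * d2) ≤ (al * be * ga) * (d1 * d2 * d3) := by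
    have : (al * be * ga) * (d1 * d2 * d1) ≤ (al * be * ga) * (d1 * d2 * d3) := by
      gcongr; linarith
    linarith
  have f2 : d3 * X ^ 2 ≤ al ^ 2 * (d1 * d2 * d3) := by
    calc d3 * X ^ 2 ≤ d3 * (al * d1) ^ 2 := by gcongr
      _ = al ^ 2 * (d1 * d1 * d3) := by ring
      _ ≤ _ := by gcongr
  have f3 : d2 * Y ^ 2 ≤ be ^ 2 * (d1 * d2 * d3) := by
    calc d2 * Y ^ 2 ≤ d2 * (be * d1) ^ 2 := by gcongr
      _ = be ^ 2 * (d1 * d2 * d1) := by ring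
      _ ≤ _ := by gcongr; linarith
  have f4 : d1 * Z ^ 2 ≤ ga ^ 2 * (d1 * d2 * d3) := by
    calc d1 * Z ^ 2 ≤ d1 * (ga * d2) ^ 2 := by gcongr
      _ = ga ^ 2 * (d1 * d2 * d2) := by ring
      _ ≤ _ := by gcongr
  have hD : 0 < d1 * d2 * d3 := by positivity
  nlinarith [mul_le_mul_of_nonneg_right hc hD.le]

lemma reduce_abs (d1 d2 d3 X Y Z : ℝ) (h1 : 0 < d1) (h12 : d1 ≤ d2) (h23 : d2 ≤ d3)
    (hX : 0 ≤ X) (hY : 0 ≤ Y) (hZ : 0 ≤ Z) (hXd : X ≤ d1 / 2) (hYd : Y ≤ d1 / 2) (hZd : Z ≤ d2 / 2)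
    (hs : X + Y + Z ≤ (d1 + d2) / 2)
    (hdet : d1 * d2 * d3 - 2 * X * Y * Z - d1 * Z^2 - d2 * Y^2 - d3 * X^2 ≤ 1) :
    d1 * d2 * d3 ≤ 6 := by
  have h2 : 0 < d2 := by linarith
  have h3 : 0 < d3 := by linarith
  have hD : 0 < d1 * d2 * d3 := by positivity
  by_cases hc : 2 * d1 ≤ d2
  · have f1 : X * Y * Z ≤ (d1 / 2) * (d1 / 2) * (d2 / 2) := by gcongr
    have f2 : X ^ 2 ≤ (d1 / 2) ^ 2 := by gcongr
    have f3 : Y ^ 2 ≤ (d1 / 2) ^ 2 := by gcongr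
    have f4 : Z ^ 2 ≤ (d2 / 2) ^ 2 := by gcongr
    have g2 : d3 * X ^ 2 ≤ (d1 * d2 * d3) / 8 := by
      calc d3 * X ^ 2 ≤ d3 * (d1 / 2) ^ 2 := by gcongr
        _ = (d1 * (2 * d1) * d3) / 8 := by ring
        _ ≤ _ := by gcongr
    have g3 : d2 * Y ^ 2 ≤ (d1 * d2 * d3) / 8 := by
      calc d2 * Y ^ 2 ≤ d2 * (d1 / 2) ^ 2 := by gcongr
        _ = (d1 * d2 * (2 * d1)) / 8 := by ring
        _ ≤ _ := by gcongr; linarith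
    have g4 : d1 * Z ^ 2 ≤ (d1 * d2 * d3) / 4 := by
      calc d1 * Z ^ 2 ≤ d1 * (d2 / 2) ^ 2 := by gcongr
        _ = (d1 * d2 * d2) / 4 := by ring
        _ ≤ _ := by gcongr
    have g1 : X * Y * Z ≤ (d1 * d2 * d3) / 16 := by
      calc X * Y * Z ≤ (d1 / 2) * (d1 / 2) * (d2 / 2) := f1
        _ = (d1 * d2 * (2 * d1)) / 16 := by ring
        _ ≤ _ := by gcongr; linarith
    linarith
  · push Not at hc
    by_cases a1 : X ≤ 3/8 * d1
    · have := reduce_aux d1 d2 d3 X Y Z h1 h12 h23 hX hY hZ (3/8) (1/2) (1/2) (11/64) a1 (by linarith)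
        (by linarith) (by norm_num) (by norm_num) (by norm_num) (by norm_num)
      linarith
    by_cases a2 : Y ≤ 3/8 * d1
    · have := reduce_aux d1 d2 d3 X Y Z h1 h12 h23 hX hY hZ (1/2) (3/8) (1/2) (11/64) (by linarith) a2
        (by linarith) (by norm_num) (by norm_num) (by norm_num) (by norm_num)
      linarith
    by_cases a3 : Z ≤ 3/8 * d2
    · have := reduce_aux d1 d2 d3 X Y Z h1 h12 h23 hX hY hZ (1/2) (1/2) (3/8) (11/64) (by linarith)
        (by linarith) a3 (by norm_num) (by norm_num) (by norm_num) (by norm_num)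
      linarith
    push Not at a1 a2 a3
    linarith

lemma reduce_ord (d1 d2 d3 x y z : ℝ) (h1 : 0 < d1) (h12 : d1 ≤ d2) (h23 : d2 ≤ d3)
    (hx : |x| ≤ d1 / 2) (hy : |y| ≤ d1 / 2) (hz : |z| ≤ d2 / 2)
    (s1 : 0 ≤ d1 + d2 + 2 * (x + y + z)) (s2 : 0 ≤ d1 + d2 + 2 * (x - y - z))
    (s3 : 0 ≤ d1 + d2 + 2 * (-x + y - z)) (s4 : 0 ≤ d1 + d2 + 2 * (-x - y + z))
    (hdet : d1 * d2 * d3 + 2 * x * y * z - d1 * z^2 - d2 * y^2 - d3 * x^2 = 1) :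
    d1 * d2 * d3 ≤ 6 := by
  by_cases hp : 0 ≤ x * y * z
  · have := reduce_aux d1 d2 d3 |x| |y| |z| h1 h12 h23 (abs_nonneg _) (abs_nonneg _) (abs_nonneg _)
      (1/2) (1/2) (1/2) 0 (by linarith) (by linarith) (by linarith) (by norm_num) (by norm_num)
      (by norm_num) (by norm_num)
    have h2 : 0 < d2 := by linarith
    have h3 : 0 < d3 := by linarith
    have f2 : x ^ 2 ≤ (d1 / 2) ^ 2 := by rw [← sq_abs]; gcongr
    have f3 : y ^ 2 ≤ (d1 / 2) ^ 2 := by rw [← sq_abs]; gcongr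
    have f4 : z ^ 2 ≤ (d2 / 2) ^ 2 := by rw [← sq_abs]; gcongr
    have g2 : d3 * x ^ 2 ≤ (d1 * d2 * d3) / 4 := by
      calc d3 * x ^ 2 ≤ d3 * (d1 / 2) ^ 2 := by gcongr
        _ = (d1 * d1 * d3) / 4 := by ring
        _ ≤ _ := by gcongr
    have g3 : d2 * y ^ 2 ≤ (d1 * d2 * d3) / 4 := by
      calc d2 * y ^ 2 ≤ d2 * (d1 / 2) ^ 2 := by gcongr
        _ = (d1 * d2 * d1) / 4 := by ring
        _ ≤ _ := by gcongr; linarith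
    have g4 : d1 * z ^ 2 ≤ (d1 * d2 * d3) / 4 := by
      calc d1 * z ^ 2 ≤ d1 * (d2 / 2) ^ 2 := by gcongr
        _ = (d1 * d2 * d2) / 4 := by ring
        _ ≤ _ := by gcongr
    linarith
  · push Not at hp
    have hxyz : |x| * |y| * |z| = - (x * y * z) := by
      rw [← abs_mul, ← abs_mul, abs_of_neg hp]
    refine reduce_abs d1 d2 d3 |x| |y| |z| h1 h12 h23 (abs_nonneg _) (abs_nonneg _) (abs_nonneg _)
      hx hy hz ?_ ?_
    · rcases le_total 0 x with a | a <;> rcases le_total 0 y with b | b <;>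
        rcases le_total 0 z with c | c <;>
        simp only [abs_of_nonneg, abs_of_nonpos, a, b, c] at * <;> first | linarith | skip
    · rw [sq_abs, sq_abs, sq_abs]; nlinarith

lemma reduce_sym (d1 d2 d3 x y z : ℝ) (h1 : 0 < d1) (h2 : 0 < d2) (h3 : 0 < d3)
    (k3 : ∀ c e : ℤ, 0 ≤ 2*c*y + 2*e*z + 2*c*e*x + c^2*d1 + e^2*d2)
    (k2 : ∀ c e : ℤ, 0 ≤ 2*c*x + 2*e*z + 2*c*e*y + c^2*d1 + e^2*d3)
    (k1 : ∀ c e : ℤ, 0 ≤ 2*c*x + 2*e*y + 2*c*e*z + c^2*d2 + e^2*d3)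
    (hdet : d1 * d2 * d3 + 2 * x * y * z - d1 * z^2 - d2 * y^2 - d3 * x^2 = 1) :
    d1 * d2 * d3 ≤ 6 := by
  have k3a := k3 1 0
  have k3b := k3 (-1) 0
  have k3c := k3 0 1
  have k3d := k3 0 (-1)
  have k3e := k3 1 1
  have k3f := k3 1 (-1)
  have k3g := k3 (-1) 1
  have k3h := k3 (-1) (-1)
  have k2a := k2 1 0
  have k2b := k2 (-1) 0
  have k2c := k2 0 1
  have k2d := k2 0 (-1)
  have k2e := k2 1 1
  have k2f := k2 1 (-1)
  have k2g := k2 (-1) 1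
  have k2h := k2 (-1) (-1)
  have k1a := k1 1 0
  have k1b := k1 (-1) 0
  have k1c := k1 0 1
  have k1d := k1 0 (-1)
  have k1e := k1 1 1
  have k1f := k1 1 (-1)
  have k1g := k1 (-1) 1
  have k1h := k1 (-1) (-1)
  clear k1 k2 k3
  push_cast at *
  rcases le_total d1 d2 with a | a <;> rcases le_total d2 d3 with b | b <;>
    rcases le_total d1 d3 with c | c
  · exact reduce_ord d1 d2 d3 x y z h1 a b (abs_le.2 ⟨by linarith, by linarith⟩)
      (abs_le.2 ⟨by linarith, by linarith⟩) (abs_le.2 ⟨by linarith, by linarith⟩) (by linarith)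
      (by linarith) (by linarith) (by linarith) (by linarith)
  · exact reduce_ord d1 d2 d3 x y z h1 a b (abs_le.2 ⟨by linarith, by linarith⟩)
      (abs_le.2 ⟨by linarith, by linarith⟩) (abs_le.2 ⟨by linarith, by linarith⟩) (by linarith)
      (by linarith) (by linarith) (by linarith) (by linarith)
  · have := reduce_ord d1 d3 d2 y x z h1 c b (abs_le.2 ⟨by linarith, by linarith⟩)
      (abs_le.2 ⟨by linarith, by linarith⟩) (abs_le.2 ⟨by linarith, by linarith⟩) (by linarith)
      (by linarith) (by linarith) (by linarith) (by linarith)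
    linarith
  · have := reduce_ord d3 d1 d2 y z x h3 c a (abs_le.2 ⟨by linarith, by linarith⟩)
      (abs_le.2 ⟨by linarith, by linarith⟩) (abs_le.2 ⟨by linarith, by linarith⟩) (by linarith)
      (by linarith) (by linarith) (by linarith) (by linarith)
    linarith
  · have := reduce_ord d2 d1 d3 x z y h2 a c (abs_le.2 ⟨by linarith, by linarith⟩)
      (abs_le.2 ⟨by linarith, by linarith⟩) (abs_le.2 ⟨by linarith, by linarith⟩) (by linarith)
      (by linarith) (by linarith) (by linarith) (by linarith)
    linarith
  · have := reduce_ord d2 d3 d1 z x y h2 b c (abs_le.2 ⟨by linarith, by linarith⟩)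
      (abs_le.2 ⟨by linarith, by linarith⟩) (abs_le.2 ⟨by linarith, by linarith⟩) (by linarith)
      (by linarith) (by linarith) (by linarith) (by linarith)
    linarith
  · have := reduce_ord d3 d2 d1 z y x h3 b a (abs_le.2 ⟨by linarith, by linarith⟩)
      (abs_le.2 ⟨by linarith, by linarith⟩) (abs_le.2 ⟨by linarith, by linarith⟩) (by linarith)
      (by linarith) (by linarith) (by linarith) (by linarith)
    linarith
  · have := reduce_ord d3 d2 d1 z y x h3 b a (abs_le.2 ⟨by linarith, by linarith⟩)
      (abs_le.2 ⟨by linarith, by linarith⟩) (abs_le.2 ⟨by linarith, by linarith⟩) (by linarith)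
      (by linarith) (by linarith) (by linarith) (by linarith)
    linarith

lemma card_Icc_le (lo hi : ℝ) (h : lo ≤ hi) :
    ((Finset.Icc ⌈lo⌉ ⌊hi⌋).card : ℝ) ≤ hi - lo + 1 := by
  rw [Int.card_Icc]
  have h1 := Int.floor_le hi
  have h2 := Int.le_ceil lo
  rcases le_total 0 (⌊hi⌋ + 1 - ⌈lo⌉) with h3 | h3
  · have : (((⌊hi⌋ + 1 - ⌈lo⌉).toNat : ℤ) : ℝ) = ((⌊hi⌋ + 1 - ⌈lo⌉ : ℤ) : ℝ) := by
      rw [Int.toNat_of_nonneg h3]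
    rw [Int.cast_natCast] at this
    rw [this]; push_cast; linarith
  · rw [Int.toNat_of_nonpos h3]; push_cast; linarith

lemma strip_vol (m c k : ℝ) (hm : m ≠ 0) :
    volume {s : ℝ | |c + s * m| ≤ k} ≤ ENNReal.ofReal (2 * k / |m|) := by
  have hm' : 0 < |m| := abs_pos.2 hm
  have : {s : ℝ | |c + s * m| ≤ k} ⊆ Metric.closedBall (-c / m) (k / |m|) := by
    intro s hs
    replace hs : |c + s * m| ≤ k := hs
    rw [Metric.mem_closedBall, Real.dist_eq, le_div_iff₀ hm', ← abs_mul]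
    have e : (s - -c / m) * m = c + s * m := by field_simp; ring
    rw [e]; exact hs
  refine (measure_mono this).trans ?_
  rw [Real.volume_closedBall]
  apply le_of_eq; congr 1; ring

lemma E_vol (m c k s₁ s₂ : ℝ) (hm : m ≠ 0) (hk : 0 ≤ k) (hk1 : k ≤ 1) (h : s₁ < s₂) :
    volume {s | s ∈ Set.Icc s₁ s₂ ∧ ∃ p : ℤ, |p + c + s * m| ≤ k} ≤
      ENNReal.ofReal (4 * k * (s₂ - s₁) + 6 * k / |m|) := by
  have hm' : 0 < |m| := abs_pos.2 hm
  have hl : 0 < s₂ - s₁ := sub_pos.2 h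
  set lo := -c - s₁ * m - |m| * (s₂ - s₁) - 1 with hlo
  set hi := -c - s₁ * m + |m| * (s₂ - s₁) + 1 with hhi
  have hle : lo ≤ hi := by
    have : 0 < |m| * (s₂ - s₁) := by positivity
    linarith
  have hsub : {s | s ∈ Set.Icc s₁ s₂ ∧ ∃ p : ℤ, |p + c + s * m| ≤ k} ⊆
      ⋃ p ∈ Finset.Icc ⌈lo⌉ ⌊hi⌋, {s : ℝ | |((p:ℝ) + c) + s * m| ≤ k} := by
    rintro s ⟨⟨hs1, hs2⟩, p, hp⟩
    have h1 : |(s - s₁) * m| ≤ |m| * (s₂ - s₁) := by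
      rw [abs_mul, abs_of_nonneg (by linarith : 0 ≤ s - s₁), mul_comm]
      gcongr
    rw [abs_le] at h1
    have hp' := abs_le.1 hp
    simp only [Set.mem_iUnion, Finset.mem_Icc]
    refine ⟨p, ⟨Int.ceil_le.2 ?_, Int.le_floor.2 ?_⟩, hp⟩
    · rw [hlo]; nlinarith
    · rw [hhi]; nlinarith
  calc _ ≤ _ := measure_mono hsub
    _ ≤ ∑ p ∈ Finset.Icc ⌈lo⌉ ⌊hi⌋, volume {s : ℝ | |((p:ℝ) + c) + s * m| ≤ k} :=
        measure_biUnion_finset_le _ _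
    _ ≤ ∑ p ∈ Finset.Icc ⌈lo⌉ ⌊hi⌋, ENNReal.ofReal (2 * k / |m|) :=
        Finset.sum_le_sum fun p _ => strip_vol m _ k hm
    _ = ENNReal.ofReal ((Finset.Icc ⌈lo⌉ ⌊hi⌋).card * (2 * k / |m|)) := by
        rw [Finset.sum_const, nsmul_eq_mul, ENNReal.ofReal_mul (by positivity),
          ENNReal.ofReal_natCast]
    _ ≤ _ := by
        apply ENNReal.ofReal_le_ofReal
        calc _ ≤ (hi - lo + 1) * (2 * k / |m|) := by
              gcongr; exact card_Icc_le lo hi hle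
          _ = _ := by rw [hlo, hhi]; field_simp; ring

/-- sum over a finite family -/
lemma fam_vol {ι : Type*} (F : Finset ι) (A : ι → Set ℝ) (B : Set ℝ) (v N : ℝ) (hv : 0 ≤ v)
    (hB : ∀ s ∈ B, ∃ i ∈ F, s ∈ A i)
    (hA : ∀ i ∈ F, volume (A i) ≤ ENNReal.ofReal v) (hN : (F.card : ℝ) ≤ N) :
    volume B ≤ ENNReal.ofReal (N * v) := by
  have hsub : B ⊆ ⋃ i ∈ F, A i := by
    intro s hs
    obtain ⟨i, hi, h⟩ := hB s hs
    simp only [Set.mem_iUnion]; exact ⟨i, hi, h⟩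
  calc _ ≤ _ := measure_mono hsub
    _ ≤ ∑ i ∈ F, volume (A i) := measure_biUnion_finset_le _ _
    _ ≤ ∑ i ∈ F, ENNReal.ofReal v := Finset.sum_le_sum hA
    _ = ENNReal.ofReal (F.card * v) := by
        rw [Finset.sum_const, nsmul_eq_mul, ENNReal.ofReal_mul (by positivity),
          ENNReal.ofReal_natCast]
    _ ≤ _ := by
        apply ENNReal.ofReal_le_ofReal
        gcongr

/-- `w = (p,q,r)` is short at `s`. -/
def Short (a b d T s : ℝ) (p q r : ℤ) : Prop :=
  |(q:ℝ)| ≤ d * T ∧ |(r:ℝ)| ≤ d * T ∧ |(p:ℝ) + b * r + s * (q + a * r)| ≤ d / T^2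

lemma mem_box (T d : ℝ) (hT : 1 ≤ T) (hd1 : d ≤ 1) (q : ℤ) (hq : |(q:ℝ)| ≤ d * T) :
    q ∈ Finset.Icc ⌈-T⌉ ⌊T⌋ := by
  have : d * T ≤ T := by nlinarith
  have := abs_le.1 (hq.trans this)
  exact Finset.mem_Icc.2 ⟨Int.ceil_le.2 this.1, Int.le_floor.2 this.2⟩

lemma card_box (T : ℝ) (hT : 1 ≤ T) : ((Finset.Icc ⌈-T⌉ ⌊T⌋).card : ℝ) ≤ 3 * T := by
  have := card_Icc_le (-T) T (by linarith)
  linarith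

lemma A1_vol (a b s₁ s₂ d T : ℝ) (h : s₁ < s₂) (hT : 1 ≤ T) (hd : 0 < d) (hd1 : d ≤ 1) :
    volume {s | s ∈ Set.Icc s₁ s₂ ∧ ∃ p q r : ℤ, 1 ≤ |(q:ℝ) + a * r| ∧ Short a b d T s p q r} ≤
      ENNReal.ofReal (9 * (4 * (s₂ - s₁) + 6) * d) := by
  have hl : 0 < s₂ - s₁ := sub_pos.2 h
  have hT2 : 1 ≤ T ^ 2 := one_le_pow₀ hT
  have hk1 : d / T ^ 2 ≤ 1 := div_le_one_of_le₀ (by linarith) (by linarith)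
  have hk : 0 < d / T ^ 2 := by positivity
  have := fam_vol ((Finset.Icc ⌈-T⌉ ⌊T⌋ ×ˢ Finset.Icc ⌈-T⌉ ⌊T⌋).filter
      fun x => 1 ≤ |(x.1:ℝ) + a * x.2|)
    (fun x => {s | s ∈ Set.Icc s₁ s₂ ∧ ∃ p : ℤ, |p + b * x.2 + s * (x.1 + a * x.2)| ≤ d / T^2})
    {s | s ∈ Set.Icc s₁ s₂ ∧ ∃ p q r : ℤ, 1 ≤ |(q:ℝ) + a * r| ∧ Short a b d T s p q r}
    ((4 * (s₂ - s₁) + 6) * (d / T^2)) (9 * T ^ 2) (by positivity) ?_ ?_ ?_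
  · refine this.trans (le_of_eq ?_)
    congr 1; field_simp
  · rintro s ⟨hs, p, q, r, hm, h1, h2, h3⟩
    refine ⟨(q, r), ?_, hs, p, h3⟩
    simp only [Finset.mem_filter, Finset.mem_product]
    exact ⟨⟨mem_box T d hT hd1 q h1, mem_box T d hT hd1 r h2⟩, hm⟩
  · rintro ⟨q, r⟩ hx
    have hm := (Finset.mem_filter.1 hx).2
    simp only at hm
    have hm0 : (q:ℝ) + a * r ≠ 0 := by intro h0; rw [h0] at hm; norm_num at hm
    refine (E_vol _ (b * r) (d / T^2) s₁ s₂ hm0 hk.le hk1 h).trans ?_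
    apply ENNReal.ofReal_le_ofReal
    have : 6 * (d / T^2) / |(q:ℝ) + a * r| ≤ 6 * (d / T^2) := div_le_self (by positivity) hm
    linarith
  · calc _ ≤ (((Finset.Icc ⌈-T⌉ ⌊T⌋ ×ˢ Finset.Icc ⌈-T⌉ ⌊T⌋).card : ℕ) : ℝ) := by
          exact_mod_cast Finset.card_filter_le _ _
      _ ≤ (3 * T) * (3 * T) := by
          rw [Finset.card_product]; push_cast
          have := card_box T hT
          gcongr
      _ = _ := by ring

lemma A2_vol (a b s₁ s₂ d T : ℝ) (h : s₁ < s₂) (hT : 1 ≤ T) (hd : 0 < d) (hd1 : d ≤ 1) :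
    volume {s | s ∈ Set.Icc s₁ s₂ ∧ ∃ p q r : ℤ, (1 / T ≤ |(q:ℝ) + a * r| ∧ |(q:ℝ) + a * r| ≤ 1) ∧
      Short a b d T s p q r} ≤
      ENNReal.ofReal (9 * (4 * (s₂ - s₁) + 6) * d) := by
  have hl : 0 < s₂ - s₁ := sub_pos.2 h
  have hT0 : 0 < T := by linarith
  have hT2 : 1 ≤ T ^ 2 := one_le_pow₀ hT
  have hk1 : d / T ^ 2 ≤ 1 := div_le_one_of_le₀ (by linarith) (by linarith)
  have hk : 0 < d / T ^ 2 := by positivity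
  have := fam_vol (((Finset.Icc ⌈-T⌉ ⌊T⌋).sigma
        fun r => Finset.Icc ⌈-(a * r) - 1⌉ ⌊-(a * r) + 1⌋).filter
      fun x => 1 / T ≤ |(x.2:ℝ) + a * x.1|)
    (fun x => {s | s ∈ Set.Icc s₁ s₂ ∧ ∃ p : ℤ, |p + b * x.1 + s * (x.2 + a * x.1)| ≤ d / T^2})
    {s | s ∈ Set.Icc s₁ s₂ ∧ ∃ p q r : ℤ, (1 / T ≤ |(q:ℝ) + a * r| ∧ |(q:ℝ) + a * r| ≤ 1) ∧
      Short a b d T s p q r}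
    ((4 * (s₂ - s₁) + 6) * (d / T)) (9 * T) (by positivity) ?_ ?_ ?_
  · refine this.trans (le_of_eq ?_)
    congr 1; field_simp
  · rintro s ⟨hs, p, q, r, ⟨hm, hm'⟩, h1, h2, h3⟩
    refine ⟨⟨r, q⟩, ?_, hs, p, h3⟩
    have := abs_le.1 hm'
    simp only [Finset.mem_filter, Finset.mem_sigma]
    refine ⟨⟨mem_box T d hT hd1 r h2, Finset.mem_Icc.2 ⟨Int.ceil_le.2 ?_, Int.le_floor.2 ?_⟩⟩, hm⟩ <;> linarith
  · rintro ⟨r, q⟩ hx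
    have hm := (Finset.mem_filter.1 hx).2
    simp only at hm
    have hm1 : 0 < |(q:ℝ) + a * r| := lt_of_lt_of_le (by positivity) hm
    have hm0 : (q:ℝ) + a * r ≠ 0 := abs_pos.1 hm1
    refine (E_vol _ (b * r) (d / T^2) s₁ s₂ hm0 hk.le hk1 h).trans ?_
    apply ENNReal.ofReal_le_ofReal
    have e1 : 6 * (d / T^2) / |(q:ℝ) + a * r| ≤ 6 * (d / T) := by
      calc _ ≤ 6 * (d / T^2) / (1 / T) := by gcongr
        _ = _ := by field_simp
    have e2 : d / T ^ 2 ≤ d / T := by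
      gcongr; nlinarith
    nlinarith
  · calc _ ≤ ((((Finset.Icc ⌈-T⌉ ⌊T⌋).sigma
        fun r : ℤ => Finset.Icc ⌈-(a * r) - 1⌉ ⌊-(a * r) + 1⌋).card : ℕ) : ℝ) := by
          exact_mod_cast Finset.card_filter_le _ _
      _ ≤ ∑ r ∈ Finset.Icc ⌈-T⌉ ⌊T⌋, (3:ℝ) := by
          rw [Finset.card_sigma]; push_cast
          refine Finset.sum_le_sum fun r _ => ?_
          have := card_Icc_le (-(a * r) - 1) (-(a * r) + 1) (by linarith)
          linarith
      _ ≤ _ := by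
          rw [Finset.sum_const, nsmul_eq_mul]
          have := card_box T hT
          linarith

lemma int_zero (n : ℤ) (h : |(n:ℝ)| < 1) : n = 0 := by
  have : |n| < 1 := by exact_mod_cast h
  exact Int.abs_lt_one_iff.1 this

lemma est (L L' u x y D K m l e : ℝ) (hx : |x| ≤ D) (hy : |y| ≤ D) (hL : |L| ≤ K) (hL' : |L'| ≤ K)
    (hu : |u| ≤ l) (hm : |m| * D ≤ e) : |L * y - L' * x - u * (m * y)| ≤ 2 * (K * D) + l * e := by
  have hD : 0 ≤ D := (abs_nonneg _).trans hx
  have hK : 0 ≤ K := (abs_nonneg _).trans hL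
  have hl : 0 ≤ l := (abs_nonneg _).trans hu
  have h1 : |L * y| ≤ K * D := by rw [abs_mul]; gcongr
  have h2 : |L' * x| ≤ K * D := by rw [abs_mul]; gcongr
  have h3 : |u * (m * y)| ≤ l * e := by
    rw [abs_mul, abs_mul]
    have : |m| * |y| ≤ e := le_trans (by gcongr) hm
    gcongr
  calc _ ≤ |L * y| + |L' * x| + |u * (m * y)| :=
        (abs_sub _ _).trans (by gcongr; exact abs_sub _ _)
    _ ≤ _ := by linarith

lemma prop_zero (a b d T l s s' : ℝ) (hT : 1 ≤ T) (hd : 0 < d) (hd1 : 2 * d + l * d < 1)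
    (hl : 0 ≤ l) (hs : |s - s'| ≤ l) (p q r p' q' r' : ℤ)
    (hm : |(q:ℝ) + a * r| < 1 / T) (hm' : |(q':ℝ) + a * r'| < 1 / T)
    (hw : Short a b d T s p q r) (hw' : Short a b d T s' p' q' r') :
    q * r' = q' * r ∧ p * r' = p' * r ∧ p * q' = p' * q := by
  obtain ⟨hq, hr, hL⟩ := hw
  obtain ⟨hq', hr', hL'⟩ := hw'
  have hT0 : 0 < T := by linarith
  have hld : 0 ≤ l * d := by positivity
  have hT2 : 1 ≤ T ^ 2 := one_le_pow₀ hT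
  have mD : |(q:ℝ) + a * r| * (d * T) ≤ d := by
    calc _ ≤ 1 / T * (d * T) := by gcongr
      _ = d := by field_simp
  have mD' : |(q':ℝ) + a * r'| * (d * T) ≤ d := by
    calc _ ≤ 1 / T * (d * T) := by gcongr
      _ = d := by field_simp
  have h1 : q * r' - q' * r = 0 := by
    apply int_zero
    push_cast
    have e : (q:ℝ) * r' - q' * r = (q + a * r) * r' - (q' + a * r') * r := by ring
    rw [e]
    have h1 : |((q:ℝ) + a * r) * r'| ≤ d := by
      rw [abs_mul]; exact le_trans (by gcongr) mD
    have h2 : |((q':ℝ) + a * r') * r| ≤ d := by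
      rw [abs_mul]; exact le_trans (by gcongr) mD'
    have := abs_sub (((q:ℝ) + a * r) * r') (((q':ℝ) + a * r') * r)
    linarith
  have h1r : (q:ℝ) * r' = q' * r := by exact_mod_cast sub_eq_zero.1 h1
  have hb : 2 * (d / T^2 * (d * T)) + l * d < 1 := by
    have : d / T^2 * (d * T) ≤ d := by
      have : d / T^2 * (d * T) = d * d / T := by field_simp
      rw [this]
      have hdd : d ≤ 1 := by linarith
      calc d * d / T ≤ d * d := div_le_self (by positivity) hT
        _ ≤ d := by nlinarith
    linarith
  refine ⟨by linarith, ?_, ?_⟩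
  · apply sub_eq_zero.1
    apply int_zero
    push_cast
    have := est _ _ (s - s') (r:ℝ) (r':ℝ) (d * T) (d / T^2) (q + a * r) l d hr hr' hL hL' hs mD
    refine lt_of_le_of_lt (le_of_eq ?_) (this.trans_lt hb)
    congr 1
    linear_combination (-s') * h1r
  · apply sub_eq_zero.1
    apply int_zero
    push_cast
    have := est _ _ (s - s') (q:ℝ) (q':ℝ) (d * T) (d / T^2) (q + a * r) l d hq hq' hL hL' hs mD
    refine lt_of_le_of_lt (le_of_eq ?_) (this.trans_lt hb)
    congr 1
    linear_combination (b + s' * a) * h1r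

lemma A3_vol (a b s₁ s₂ d T R : ℝ) (h : s₁ < s₂) (hT : 1 ≤ T) (hd : 0 < d)
    (hd1 : 2 * d + (s₂ - s₁) * d < 1) (hR : 0 < R) (hdR : d ≤ R / 4)
    (hsup : ∀ p q r : ℤ, ¬ (p = 0 ∧ q = 0 ∧ r = 0) → |(q:ℝ)| ≤ d * T → |(r:ℝ)| ≤ d * T →
      ∃ s ∈ Set.Icc s₁ s₂, R / 2 ≤ T ^ 2 * |(p:ℝ) + b * r + s * (q + a * r)|) :
    volume {s | s ∈ Set.Icc s₁ s₂ ∧ ∃ p q r : ℤ, ¬ (p = 0 ∧ q = 0 ∧ r = 0) ∧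
      |(q:ℝ) + a * r| < 1 / T ∧ Short a b d T s p q r} ≤
      ENNReal.ofReal (8 * (s₂ - s₁) / R * d) := by
  classical
  have hT0 : 0 < T := by linarith
  have hl : 0 < s₂ - s₁ := sub_pos.2 h
  by_cases hne : ∃ n : ℕ, ∃ p q r : ℤ, n = p.natAbs + q.natAbs + r.natAbs ∧
      ∃ s ∈ Set.Icc s₁ s₂, ¬ (p = 0 ∧ q = 0 ∧ r = 0) ∧
      |(q:ℝ) + a * r| < 1 / T ∧ Short a b d T s p q r
  swap
  · have : {s | s ∈ Set.Icc s₁ s₂ ∧ ∃ p q r : ℤ, ¬ (p = 0 ∧ q = 0 ∧ r = 0) ∧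
      |(q:ℝ) + a * r| < 1 / T ∧ Short a b d T s p q r} ⊆ ∅ := by
      rintro s ⟨hs, p, q, r, h1, h2, h3⟩
      exact (hne ⟨_, p, q, r, rfl, s, hs, h1, h2, h3⟩).elim
    refine (measure_mono this).trans ?_
    simp
  have hmin := fun m => Nat.find_min' hne (m := m)
  obtain ⟨p, q, r, hn, s0, hs0, hw0, hm0, hS0⟩ := Nat.find_spec hne
  have key : {s | s ∈ Set.Icc s₁ s₂ ∧ ∃ p q r : ℤ, ¬ (p = 0 ∧ q = 0 ∧ r = 0) ∧
      |(q:ℝ) + a * r| < 1 / T ∧ Short a b d T s p q r} ⊆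
      {s : ℝ | |((p:ℝ) + b * r) + s * (q + a * r)| ≤ d / T^2} := by
    rintro s ⟨hs, p', q', r', hw', hm', hS'⟩
    have hle := hmin _ ⟨p', q', r', rfl, s, hs, hw', hm', hS'⟩
    rw [hn] at hle
    have hss : |s0 - s| ≤ s₂ - s₁ := by
      rw [abs_le]; constructor <;> linarith [hs.1, hs.2, hs0.1, hs0.2]
    obtain ⟨e1, e2, e3⟩ := prop_zero a b d T (s₂ - s₁) s0 s hT hd hd1 hl.le hss p q r p' q' r'
      hm0 hm' hS0 hS'
    have e1' : (q:ℝ) * r' = q' * r := by exact_mod_cast e1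
    have e2' : (p:ℝ) * r' = p' * r := by exact_mod_cast e2
    have e3' : (p:ℝ) * q' = p' * q := by exact_mod_cast e3
    have hle' : |(p:ℝ)| + |(q:ℝ)| + |(r:ℝ)| ≤ |(p':ℝ)| + |(q':ℝ)| + |(r':ℝ)| := by
      have : ((p.natAbs + q.natAbs + r.natAbs : ℕ) : ℝ) ≤
        ((p'.natAbs + q'.natAbs + r'.natAbs : ℕ) : ℝ) := by exact_mod_cast hle
      push_cast [Nat.cast_natAbs] at this
      exact this
    have hpos : 0 < |(p':ℝ)| + |(q':ℝ)| + |(r':ℝ)| := by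
      by_contra hcon
      push Not at hcon
      have a1 := abs_nonneg (p':ℝ)
      have a2 := abs_nonneg (q':ℝ)
      have a3 := abs_nonneg (r':ℝ)
      apply hw'
      refine ⟨?_, ?_, ?_⟩
      · exact_mod_cast abs_eq_zero.1 (by linarith : |(p':ℝ)| = 0)
      · exact_mod_cast abs_eq_zero.1 (by linarith : |(q':ℝ)| = 0)
      · exact_mod_cast abs_eq_zero.1 (by linarith : |(r':ℝ)| = 0)
    have hL' := hS'.2.2
    show |((p:ℝ) + b * r) + s * (q + a * r)| ≤ d / T^2
    set L := ((p:ℝ) + b * r) + s * (q + a * r) with hLdef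
    set L' := ((p':ℝ) + b * r') + s * (q' + a * r') with hLdef'
    have f1 : (p':ℝ) * L = p * L' := by
      rw [hLdef, hLdef']; linear_combination (-b - s * a) * e2' - s * e3'
    have f2 : (q':ℝ) * L = q * L' := by
      rw [hLdef, hLdef']; linear_combination (-b - s * a) * e1' + e3'
    have f3 : (r':ℝ) * L = r * L' := by
      rw [hLdef, hLdef']; linear_combination e2' + s * e1'
    have g1 : |(p':ℝ)| * |L| = |(p:ℝ)| * |L'| := by rw [← abs_mul, f1, abs_mul]
    have g2 : |(q':ℝ)| * |L| = |(q:ℝ)| * |L'| := by rw [← abs_mul, f2, abs_mul]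
    have g3 : |(r':ℝ)| * |L| = |(r:ℝ)| * |L'| := by rw [← abs_mul, f3, abs_mul]
    refine le_of_mul_le_mul_left ?_ hpos
    calc (|(p':ℝ)| + |(q':ℝ)| + |(r':ℝ)|) * |L| = (|(p:ℝ)| + |(q:ℝ)| + |(r:ℝ)|) * |L'| := by
          linear_combination g1 + g2 + g3
      _ ≤ _ := by gcongr
  obtain ⟨s', hs', hR'⟩ := hsup p q r hw0 hS0.1 hS0.2.1
  have hL0 := hS0.2.2
  have hlow : R / (4 * T^2) ≤ |(q:ℝ) + a * r| * (s₂ - s₁) := by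
    have h1 : R / (2 * T^2) ≤ |(p:ℝ) + b * r + s' * (q + a * r)| := by
      rw [div_le_iff₀ (by positivity)]; linarith
    have h2 : |(p:ℝ) + b * r + s' * (q + a * r)| ≤
        |(p:ℝ) + b * r + s0 * (q + a * r)| + |(q:ℝ) + a * r| * |s' - s0| := by
      rw [← abs_mul]
      refine le_trans (le_of_eq ?_) (abs_add_le _ _)
      congr 1; ring
    have h3 : |s' - s0| ≤ s₂ - s₁ := by
      rw [abs_le]; constructor <;> linarith [hs'.1, hs'.2, hs0.1, hs0.2]
    have h4 : |(q:ℝ) + a * r| * |s' - s0| ≤ |(q:ℝ) + a * r| * (s₂ - s₁) := by gcongr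
    have h5 : d / T^2 ≤ R / (4 * T^2) := by
      rw [← div_div]; gcongr
    have h6 : R / (2 * T^2) = 2 * (R / (4 * T^2)) := by field_simp; ring
    linarith
  have hmpos : 0 < |(q:ℝ) + a * r| := by
    have : 0 < |(q:ℝ) + a * r| * (s₂ - s₁) := lt_of_lt_of_le (by positivity) hlow
    exact pos_of_mul_pos_left this hl.le
  refine (measure_mono key).trans ((strip_vol _ _ _ (abs_pos.1 hmpos)).trans ?_)
  apply ENNReal.ofReal_le_ofReal
  rw [div_le_iff₀ hmpos]
  calc 2 * (d / T^2) = 8 * d / R * (R / (4 * T^2)) := by field_simp; ring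
    _ ≤ 8 * d / R * (|(q:ℝ) + a * r| * (s₂ - s₁)) := by gcongr
    _ = _ := by ring

lemma bad_vol (a b s₁ s₂ d T R : ℝ) (h : s₁ < s₂) (hT : 1 ≤ T) (hd : 0 < d)
    (hd1 : 2 * d + (s₂ - s₁) * d < 1) (hR : 0 < R) (hdR : d ≤ R / 4)
    (hsup : ∀ p q r : ℤ, ¬ (p = 0 ∧ q = 0 ∧ r = 0) → |(q:ℝ)| ≤ d * T → |(r:ℝ)| ≤ d * T →
      ∃ s ∈ Set.Icc s₁ s₂, R / 2 ≤ T ^ 2 * |(p:ℝ) + b * r + s * (q + a * r)|) :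
    volume {s | s ∈ Set.Icc s₁ s₂ ∧ ∃ p q r : ℤ, ¬ (p = 0 ∧ q = 0 ∧ r = 0) ∧
      Short a b d T s p q r} ≤
      ENNReal.ofReal ((18 * (4 * (s₂ - s₁) + 6) + 8 * (s₂ - s₁) / R) * d) := by
  have hl : 0 < s₂ - s₁ := sub_pos.2 h
  have hdd : d ≤ 1 := by nlinarith
  have h1 := A1_vol a b s₁ s₂ d T h hT hd hdd
  have h2 := A2_vol a b s₁ s₂ d T h hT hd hdd
  have h3 := A3_vol a b s₁ s₂ d T R h hT hd hd1 hR hdR hsup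
  set S1 := {s | s ∈ Set.Icc s₁ s₂ ∧ ∃ p q r : ℤ, 1 ≤ |(q:ℝ) + a * r| ∧ Short a b d T s p q r}
  set S2 := {s | s ∈ Set.Icc s₁ s₂ ∧ ∃ p q r : ℤ, (1 / T ≤ |(q:ℝ) + a * r| ∧ |(q:ℝ) + a * r| ≤ 1) ∧
      Short a b d T s p q r}
  set S3 := {s | s ∈ Set.Icc s₁ s₂ ∧ ∃ p q r : ℤ, ¬ (p = 0 ∧ q = 0 ∧ r = 0) ∧
      |(q:ℝ) + a * r| < 1 / T ∧ Short a b d T s p q r}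
  have hsub : {s | s ∈ Set.Icc s₁ s₂ ∧ ∃ p q r : ℤ, ¬ (p = 0 ∧ q = 0 ∧ r = 0) ∧
      Short a b d T s p q r} ⊆ (S1 ∪ S2) ∪ S3 := by
    rintro s ⟨hs, p, q, r, hw, hS⟩
    rcases le_total 1 |(q:ℝ) + a * r| with h1 | h1
    · exact Or.inl (Or.inl ⟨hs, p, q, r, h1, hS⟩)
    rcases le_or_gt (1 / T) |(q:ℝ) + a * r| with h2 | h2
    · exact Or.inl (Or.inr ⟨hs, p, q, r, ⟨h2, h1⟩, hS⟩)
    · exact Or.inr ⟨hs, p, q, r, hw, h2, hS⟩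
  calc _ ≤ _ := measure_mono hsub
    _ ≤ volume S1 + volume S2 + volume S3 :=
        (measure_union_le _ _).trans (by gcongr; exact measure_union_le _ _)
    _ ≤ ENNReal.ofReal (9 * (4 * (s₂ - s₁) + 6) * d) + ENNReal.ofReal (9 * (4 * (s₂ - s₁) + 6) * d)
        + ENNReal.ofReal (8 * (s₂ - s₁) / R * d) := by gcongr
    _ = _ := by
        rw [← ENNReal.ofReal_add (by positivity) (by positivity),
          ← ENNReal.ofReal_add (by positivity) (by positivity)]
        congr 1; ring

/-- squared Hilbert-Schmidt norm -/
def Psi (M : Matrix (Fin 3) (Fin 3) ℝ) : ℝ := ∑ i, ∑ j, (M i j) ^ 2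

lemma Psi_entry (M : Matrix (Fin 3) (Fin 3) ℝ) (i j : Fin 3) : (M i j)^2 ≤ Psi M := by
  unfold Psi
  calc (M i j)^2 ≤ ∑ j, (M i j)^2 :=
        Finset.single_le_sum (f := fun j => (M i j)^2) (fun _ _ => sq_nonneg _) (Finset.mem_univ j)
    _ ≤ _ := Finset.single_le_sum (f := fun i => ∑ j, (M i j)^2)
        (fun _ _ => Finset.sum_nonneg fun _ _ => sq_nonneg _) (Finset.mem_univ i)

abbrev GZ := Matrix.SpecialLinearGroup (Fin 3) ℤ

def toR (γ : GZ) : G := Matrix.SpecialLinearGroup.map (n := Fin 3) (Int.castRingHom ℝ) γ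

lemma toR_apply (γ : GZ) (i j : Fin 3) : (toR γ : Matrix (Fin 3) (Fin 3) ℝ) i j = ((γ.1 i j : ℤ) : ℝ) := by
  simp [toR]

lemma toR_mul (γ γ' : GZ) : toR (γ * γ') = toR γ * toR γ' := by simp [toR]

lemma finite_sub (g : G) (c : ℝ) : {γ : GZ | Psi (g * toR γ : G).1 ≤ c}.Finite := by
  set A : ℝ := ∑ i, ∑ k, |(g⁻¹ : G).1 i k| with hA
  set N : ℤ := ⌈A * (c + 1)⌉ with hN
  have hfin : (Set.Icc (fun _ _ => -N : Fin 3 → Fin 3 → ℤ) (fun _ _ => N)).Finite := Set.finite_Icc _ _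
  refine (hfin.preimage (f := fun γ : GZ => (γ.1 : Fin 3 → Fin 3 → ℤ)) ?_).subset ?_
  · intro x _ y _ hxy
    exact Subtype.ext hxy
  · intro γ hγ
    replace hγ : Psi (g * toR γ : G).1 ≤ c := hγ
    have hb : ∀ i j, |(γ.1 i j : ℝ)| ≤ N := by
      intro i j
      have e : toR γ = g⁻¹ * (g * toR γ) := by group
      have e2 : ((γ.1 i j : ℤ):ℝ) = ∑ k, (g⁻¹ : G).1 i k * (g * toR γ : G).1 k j := by
        rw [← toR_apply, ← Matrix.mul_apply]
        conv_lhs => rw [e]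
        rfl
      have e3 : ∀ k, |(g * toR γ : G).1 k j| ≤ c + 1 := by
        intro k
        have := (Psi_entry (g * toR γ : G).1 k j).trans hγ
        rw [abs_le]; constructor <;> nlinarith [sq_nonneg ((g * toR γ : G).1 k j + 1), sq_nonneg ((g * toR γ : G).1 k j - 1)]
      have hc : 0 ≤ c + 1 := (abs_nonneg _).trans (e3 0)
      rw [e2]
      calc _ ≤ ∑ k, |(g⁻¹ : G).1 i k * (g * toR γ : G).1 k j| := Finset.abs_sum_le_sum_abs _ _
        _ ≤ ∑ k, |(g⁻¹ : G).1 i k| * (c + 1) := by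
            refine Finset.sum_le_sum fun k _ => ?_
            rw [abs_mul]; gcongr; exact e3 k
        _ = (∑ k, |(g⁻¹ : G).1 i k|) * (c + 1) := by rw [Finset.sum_mul]
        _ ≤ A * (c + 1) := by
            gcongr
            exact Finset.single_le_sum (f := fun i => ∑ k, |(g⁻¹ : G).1 i k|)
              (fun _ _ => Finset.sum_nonneg fun _ _ => abs_nonneg _) (Finset.mem_univ i)
        _ ≤ _ := Int.le_ceil _
    have hb' : ∀ i j, |γ.1 i j| ≤ N := by
      intro i j; exact_mod_cast hb i j
    exact ⟨fun i j => (abs_le.1 (hb' i j)).1, fun i j => (abs_le.1 (hb' i j)).2⟩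

lemma exists_min (g : G) : ∃ γ : GZ, ∀ γ' : GZ, Psi (g * toR γ : G).1 ≤ Psi (g * toR γ' : G).1 := by
  obtain ⟨γ, hγ, hmin⟩ := Set.exists_min_image {γ : GZ | Psi (g * toR γ : G).1 ≤ Psi (g * toR 1 : G).1}
    (fun γ => Psi (g * toR γ : G).1) (finite_sub g _) ⟨1, by exact le_refl (Psi (g * toR 1 : G).1)⟩
  refine ⟨γ, fun γ' => ?_⟩
  rcases le_total (Psi (g * toR γ' : G).1) (Psi (g * toR 1 : G).1) with h | h
  · exact hmin γ' h
  · exact le_trans hγ h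

def E1 (c e : ℤ) : GZ := ⟨!![1, 0, 0; c, 1, 0; e, 0, 1], by simp [Matrix.det_fin_three]⟩
def E2 (c e : ℤ) : GZ := ⟨!![1, c, 0; 0, 1, 0; 0, e, 1], by simp [Matrix.det_fin_three]⟩
def E3 (c e : ℤ) : GZ := ⟨!![1, 0, c; 0, 1, e; 0, 0, 1], by simp [Matrix.det_fin_three]⟩

/-- Gram matrix entries. -/
def gr (M : Matrix (Fin 3) (Fin 3) ℝ) (i j : Fin 3) : ℝ := ∑ k, M k i * M k j

lemma mahler_box (g : G) (δ : ℝ) (hδ : 0 < δ)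
    (hg : ∀ v : Fin 3 → ℤ, v ≠ 0 → δ ≤ ∑ i, (g.1.mulVec (fun i => (v i : ℝ)) i) ^ 2) :
    ∃ γ : GZ, ∀ i j, |(g * toR γ : G).1 i j| ≤ 6 / δ ^ 2 + 1 := by
  obtain ⟨γ, hmin⟩ := exists_min g
  refine ⟨γ, ?_⟩
  set M := (g * toR γ : G).1 with hM
  have hmul : ∀ E : GZ, Psi M ≤ Psi (M * (toR E).1) := by
    intro E
    have := hmin (γ * E)
    rw [toR_mul, ← mul_assoc] at this
    exact this
  have hdet : M.det = 1 := (g * toR γ : G).2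
  have hd : ∀ j, δ ≤ gr M j j := by
    intro j
    have hv : (fun i => γ.1 i j) ≠ 0 := by
      intro h0
      have : γ.1.det = 0 := Matrix.det_eq_zero_of_column_eq_zero j (fun i => congrFun h0 i)
      rw [γ.2] at this
      exact one_ne_zero this
    refine (hg _ hv).trans (le_of_eq ?_)
    unfold gr
    refine Finset.sum_congr rfl fun i _ => ?_
    have : g.1.mulVec (fun i => ((γ.1 i j : ℤ) : ℝ)) i = M i j := by
      rw [hM]
      simp only [← toR_apply]
      rfl
    rw [this, sq]
  have hD := reduce_sym (gr M 0 0) (gr M 1 1) (gr M 2 2) (gr M 0 1) (gr M 0 2) (gr M 1 2)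
    (hδ.trans_le (hd 0)) (hδ.trans_le (hd 1)) (hδ.trans_le (hd 2)) ?_ ?_ ?_ ?_
  · have hj : ∀ j, gr M j j ≤ 6 / δ ^ 2 := by
      have h0 := hd 0
      have h1 := hd 1
      have h2 := hd 2
      have key : ∀ u v w : ℝ, δ ≤ u → δ ≤ v → δ ≤ w → u * v * w ≤ 6 → w ≤ 6 / δ^2 := by
        intro u v w hu hv hw h
        rw [le_div_iff₀ (by positivity)]
        have : δ * δ ≤ u * v := mul_le_mul hu hv hδ.le (hδ.le.trans hu)
        nlinarith
      intro j
      fin_cases j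
      · exact key _ _ (gr M 0 0) h1 h2 h0 (by linarith)
      · exact key _ _ (gr M 1 1) h0 h2 h1 (by linarith)
      · exact key _ _ (gr M 2 2) h0 h1 h2 (by linarith)
    intro i j
    have h1 : (M i j)^2 ≤ gr M j j := by
      have := Finset.single_le_sum (f := fun k => M k j * M k j) (fun _ _ => mul_self_nonneg _)
        (Finset.mem_univ i)
      rw [sq]; exact this
    have h2 := h1.trans (hj j)
    rw [abs_le]; constructor <;> nlinarith [sq_nonneg (M i j + 1), sq_nonneg (M i j - 1)]
  · intro c e
    have := sub_nonneg.2 (hmul (E3 c e))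
    refine this.trans (le_of_eq ?_)
    simp only [Psi, gr, Matrix.mul_apply, Fin.sum_univ_three, toR_apply]
    simp [E3]
    ring
  · intro c e
    have := sub_nonneg.2 (hmul (E2 c e))
    refine this.trans (le_of_eq ?_)
    simp only [Psi, gr, Matrix.mul_apply, Fin.sum_univ_three, toR_apply]
    simp [E2]
    ring
  · intro c e
    have := sub_nonneg.2 (hmul (E1 c e))
    refine this.trans (le_of_eq ?_)
    simp only [Psi, gr, Matrix.mul_apply, Fin.sum_univ_three, toR_apply]
    simp [E1]
    ring
  · have h2 : M.det ^ 2 = 1 := by rw [hdet]; norm_num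
    rw [← h2, Matrix.det_fin_three]
    simp only [gr, Fin.sum_univ_three]
    ring

lemma compact_box (B : ℝ) : IsCompact {g : G | ∀ i j, |g.1 i j| ≤ B} := by
  have hind : Topology.IsInducing (fun g : G => (g : Matrix (Fin 3) (Fin 3) ℝ)) := ⟨rfl⟩
  rw [hind.isCompact_iff]
  have hc : IsCompact (Set.pi Set.univ fun _ : Fin 3 => Set.pi Set.univ fun _ : Fin 3 => Set.Icc (-B) B) :=
    isCompact_univ_pi fun _ => isCompact_univ_pi fun _ => isCompact_Icc
  have hcl : IsClosed {M : Matrix (Fin 3) (Fin 3) ℝ | M.det = 1} :=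
    isClosed_eq (continuous_id.matrix_det) continuous_const
  have hc2 : IsCompact ({M : Matrix (Fin 3) (Fin 3) ℝ | ∀ i j, M i j ∈ Set.Icc (-B) B} ∩
      {M : Matrix (Fin 3) (Fin 3) ℝ | M.det = 1}) := by
    refine IsCompact.inter_right ?_ hcl
    have e : {M : Matrix (Fin 3) (Fin 3) ℝ | ∀ i j, M i j ∈ Set.Icc (-B) B} =
      Set.pi Set.univ fun _ : Fin 3 => Set.pi Set.univ fun _ : Fin 3 => Set.Icc (-B) B :=
      Set.ext fun M => ⟨fun h i _ j _ => h i j, fun h i j => h i trivial j trivial⟩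
    rw [e]; exact hc
  refine (congrArg IsCompact (Set.ext fun M => ?_)).mpr hc2
  constructor
  · rintro ⟨g, hg, rfl⟩
    exact ⟨fun i j => abs_le.1 (hg i j), g.2⟩
  · rintro ⟨h1, h2⟩
    exact ⟨⟨M, h2⟩, fun i j => abs_le.2 (h1 i j), rfl⟩

lemma compact_K (B : ℝ) : IsCompact ((fun g : G => (g : X)) '' {g : G | ∀ i j, |g.1 i j| ≤ B}) :=
  (compact_box B).image continuous_quot_mk

lemma smul_eq (t a b s : ℝ) : gSL t • phiSL a b s • x₀ = ((gSL t * phiSL a b s : G) : X) := by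
  rw [x₀, ← mul_smul]
  show (((gSL t * phiSL a b s) * 1 : G) : X) = _
  rw [mul_one]

lemma vec_eq (t a b s : ℝ) (w : Fin 3 → ℤ) :
    (gSL t * phiSL a b s : G).1.mulVec (fun i => (w i : ℝ)) =
      ![Real.exp t ^ 2 * ((w 0 : ℝ) + b * w 2 + s * (w 1 + a * w 2)), (Real.exp t)⁻¹ * w 1,
        (Real.exp t)⁻¹ * w 2] := by
  have h2 : Real.exp (2 * t) = Real.exp t ^ 2 := by rw [sq, ← Real.exp_add]; ring_nf
  have h3 : (gSL t * phiSL a b s : G).1 = (gSL t).1 * (phiSL a b s).1 := rfl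
  rw [h3, ← Matrix.mulVec_mulVec]
  ext i
  fin_cases i <;>
    simp [gSL, phiSL, Matrix.mulVec, dotProduct, Fin.sum_univ_three, Matrix.diagonal, h2, Real.exp_neg]
  ring

/-- **Proposition (Dani–Margulis nondivergence dichotomy).** For any `ε > 0` and
`R > 0` there are a compact `K ⊆ X` and `t_I ≥ 0` such that for all `t ≥ t_I`, either
`|{s ∈ I : g_t φ_{a,b}(s)·x₀ ∈ K}| ≥ (1−ε)|I|`, or some `w ∈ ℤ³ \ {0}` satisfies
`sup_{s∈I} ‖g_t φ_{a,b}(s) w‖ < R`. -/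
theorem nondivergence_dichotomy (a b s₁ s₂ : ℝ) (h : s₁ < s₂)
    (ε R : ℝ) (hε : 0 < ε) (hR : 0 < R) :
    ∃ (K : Set X) (tI : ℝ), IsCompact K ∧ 0 ≤ tI ∧
      ∀ t : ℝ, tI ≤ t →
        (ENNReal.ofReal ((1 - ε) * (s₂ - s₁)) ≤
            volume {s ∈ Set.Icc s₁ s₂ | gSL t • phiSL a b s • x₀ ∈ K}) ∨
        (∃ w : Fin 3 → ℤ, w ≠ 0 ∧ supNormOrbit a b s₁ s₂ t w < R) := by
  have hl : 0 < s₂ - s₁ := sub_pos.2 h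
  obtain ⟨d, hd, hd1, hdR, hdε⟩ : ∃ d : ℝ, 0 < d ∧ 2 * d + (s₂ - s₁) * d < 1 ∧ d ≤ R / 4 ∧
      (18 * (4 * (s₂ - s₁) + 6) + 8 * (s₂ - s₁) / R) * d ≤ ε * (s₂ - s₁) := by
    set C := 18 * (4 * (s₂ - s₁) + 6) + 8 * (s₂ - s₁) / R with hC
    have hCpos : 0 < C := by positivity
    refine ⟨min (1 / (2 * (2 + (s₂ - s₁)))) (min (R / 4) (ε * (s₂ - s₁) / C)), ?_, ?_, ?_, ?_⟩
    · positivity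
    · have h1 := min_le_left (1 / (2 * (2 + (s₂ - s₁)))) (min (R / 4) (ε * (s₂ - s₁) / C))
      have h2 : (2 + (s₂ - s₁)) * (1 / (2 * (2 + (s₂ - s₁)))) = 1 / 2 := by field_simp
      have h3 := mul_le_mul_of_nonneg_left h1 (by positivity : 0 ≤ 2 + (s₂ - s₁))
      linarith
    · exact (min_le_right _ _).trans (min_le_left _ _)
    · have h1 := (min_le_right (1 / (2 * (2 + (s₂ - s₁)))) (min (R / 4) (ε * (s₂ - s₁) / C))).trans
        (min_le_right _ _)
      calc _ ≤ C * (ε * (s₂ - s₁) / C) := by gcongr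
        _ = _ := by field_simp
  refine ⟨_, 0, compact_K (6 / (d^2) ^ 2 + 1), le_refl _, fun t ht => ?_⟩
  by_cases hw : ∃ w : Fin 3 → ℤ, w ≠ 0 ∧ supNormOrbit a b s₁ s₂ t w < R
  · exact Or.inr hw
  left
  push Not at hw
  set T := Real.exp t with hTdef
  have hT : 1 ≤ T := Real.one_le_exp ht
  have hT0 : 0 < T := by linarith
  have hbad := bad_vol a b s₁ s₂ d T R h hT hd hd1 hR hdR ?_
  · set Bad := {s | s ∈ Set.Icc s₁ s₂ ∧ ∃ p q r : ℤ, ¬ (p = 0 ∧ q = 0 ∧ r = 0) ∧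
      Short a b d T s p q r} with hBad
    set Good := {s ∈ Set.Icc s₁ s₂ | gSL t • phiSL a b s • x₀ ∈
      (fun g : G => (g : X)) '' {g : G | ∀ i j, |g.1 i j| ≤ 6 / (d^2) ^ 2 + 1}} with hGood
    have hcov : Set.Icc s₁ s₂ ⊆ Good ∪ Bad := by
      intro s hs
      by_cases hb : s ∈ Bad
      · exact Or.inr hb
      left
      refine ⟨hs, ?_⟩
      have hm := mahler_box (gSL t * phiSL a b s) (d^2) (by positivity) ?_
      · obtain ⟨γ, hγ⟩ := hm
        refine ⟨_, hγ, ?_⟩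
        rw [smul_eq]
        apply QuotientGroup.eq.2
        have : (gSL t * phiSL a b s * toR γ)⁻¹ * (gSL t * phiSL a b s) = (toR γ)⁻¹ := by group
        rw [this]
        exact inv_mem ⟨γ, rfl⟩
      · intro v hv
        by_contra hlt
        push Not at hlt
        apply hb
        rw [vec_eq, ← hTdef, Fin.sum_univ_three] at hlt
        simp only [Matrix.cons_val] at hlt
        refine ⟨hs, v 0, v 1, v 2, ?_, ?_, ?_, ?_⟩
        · rintro ⟨h0, h1, h2⟩
          apply hv
          ext i; fin_cases i <;> assumption
        · have : |T⁻¹ * (v 1 : ℝ)| ≤ d := by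
            apply abs_le_of_sq_le_sq _ hd.le
            nlinarith
          rw [abs_mul, abs_of_pos (inv_pos.2 hT0), inv_mul_le_iff₀ hT0] at this
          linarith
        · have : |T⁻¹ * (v 2 : ℝ)| ≤ d := by
            apply abs_le_of_sq_le_sq _ hd.le
            nlinarith
          rw [abs_mul, abs_of_pos (inv_pos.2 hT0), inv_mul_le_iff₀ hT0] at this
          linarith
        · have : |T ^ 2 * ((v 0 : ℝ) + b * v 2 + s * (v 1 + a * v 2))| ≤ d := by
            apply abs_le_of_sq_le_sq _ hd.le
            nlinarith
          rw [abs_mul, abs_of_pos (by positivity : 0 < T^2)] at this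
          rw [le_div_iff₀ (by positivity)]
          linarith
    have h1 : ENNReal.ofReal (s₂ - s₁) ≤ volume Good + ENNReal.ofReal (ε * (s₂ - s₁)) := by
      calc _ = volume (Set.Icc s₁ s₂) := Real.volume_Icc.symm
        _ ≤ _ := measure_mono hcov
        _ ≤ volume Good + volume Bad := measure_union_le _ _
        _ ≤ _ := by
            gcongr
            exact hbad.trans (ENNReal.ofReal_le_ofReal hdε)
    have h2 : (1 - ε) * (s₂ - s₁) = (s₂ - s₁) - ε * (s₂ - s₁) := by ring
    rw [h2, ENNReal.ofReal_sub _ (by positivity)]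
    exact tsub_le_iff_right.2 h1
  · intro p q r hpqr hq hr
    have hne : (![p, q, r] : Fin 3 → ℤ) ≠ 0 := by
      intro h0
      exact hpqr ⟨congrFun h0 0, congrFun h0 1, congrFun h0 2⟩
    have h1 := hw _ hne
    unfold supNormOrbit at h1
    have : Nonempty (Set.Icc s₁ s₂) := ⟨⟨s₁, le_refl _, h.le⟩⟩
    obtain ⟨⟨s, hs⟩, hlt⟩ := exists_lt_of_lt_ciSup (lt_of_lt_of_le (half_lt_self hR) h1)
    refine ⟨s, hs, ?_⟩
    by_contra hcon
    push Not at hcon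
    apply absurd hlt
    rw [not_lt, vec_eq, ← hTdef, pi_norm_le_iff_of_nonneg (by positivity)]
    have aux : ∀ x : ℝ, |x| ≤ d * T → |T⁻¹ * x| ≤ R / 2 := by
      intro x hx
      rw [abs_mul, abs_of_pos (inv_pos.2 hT0), inv_mul_le_iff₀ hT0]
      nlinarith
    intro i
    fin_cases i
    · simp only [Real.norm_eq_abs]
      simp only [Fin.zero_eta, Matrix.cons_val]
      rw [abs_mul, abs_of_pos (by positivity : 0 < T^2)]
      exact hcon.le
    · exact aux _ hq
    · exact aux _ hr
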